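/- arXiv:1305.7242 — 2 statements merged into one kernel-verified Lean document; each statement's English description precedes it below -/
import Mathlib

section
/- Let 0 < ρ0 < ρ1 < 1 and let G(p) = pρ1 + (1−p)ρ0. Then G has the unique fixed point p* = ρ0/(1 − ρ1 + ρ0) in (0,1), the function F(p) = ∫_0^p log( G(x)/(1−G(x)) ) dx − p log p − (1−p) log(1−p) attains its maximum uniquely at p*, and consequently lim_{N→∞} s(N;G) = 2 ρ0/(1 − ρ1 + ρ0) − 1, where s(N;G) = [ Σ_{i=0}^{N} (1/(1−G(i/N))) ( ∏_{k=1}^{i} G((k−1)/N)/(1−G((k−1)/N)) ) C(N,i) (2i/N − 1) ] / [ Σ_{i=0}^{N} (1/(1−G(i/N))) ( ∏_{k=1}^{i} G((k−1)/N)/(1−G((k−1)/N)) ) C(N,i) ]. -/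
open Filter Finset Topology

/-- The function `F(p) = ∫_0^p log(G(x)/(1-G(x))) dx - p log p - (1-p) log(1-p)`. -/
noncomputable def Ffun (G : ℝ → ℝ) (p : ℝ) : ℝ :=
  (∫ x in (0 : ℝ)..p, Real.log (G x / (1 - G x))) -
    p * Real.log p - (1 - p) * Real.log (1 - p)

/-- The speed `s(N;G)` of the random walk excited by its recent history with history
window `N` and `N` threshold levels `Mᵢ = i`, `pᵢ = G(i/N)`. -/
noncomputable def speedG (N : ℕ) (G : ℝ → ℝ) : ℝ :=
  (∑ i ∈ Finset.range (N + 1), (1 / (1 - G ((i : ℝ) / N))) *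
      (∏ k ∈ Finset.Icc 1 i, G (((k : ℝ) - 1) / N) / (1 - G (((k : ℝ) - 1) / N))) *
      (N.choose i) * (2 * (i : ℝ) / N - 1)) /
  (∑ i ∈ Finset.range (N + 1), (1 / (1 - G ((i : ℝ) / N))) *
      (∏ k ∈ Finset.Icc 1 i, G (((k : ℝ) - 1) / N) / (1 - G (((k : ℝ) - 1) / N))) *
      (N.choose i))

theorem Ffun_eq_integral_add_binEntropy (G : ℝ → ℝ) :
    Ffun G = fun p => (∫ x in (0 : ℝ)..p, Real.log (G x / (1 - G x))) + Real.binEntropy p := by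
  funext p
  simp only [Ffun, Real.binEntropy, Real.log_inv]
  ring

open MeasureTheory in
/-- If a continuous `G : ℝ → ℝ` maps `[0,1]` into `(0,1)`, then the derivative of `F` at
`p ∈ (0,1)` is `logit (G p) - logit p`. -/
theorem hasDerivAt_Ffun {G : ℝ → ℝ} (hG : Continuous G)
    (hmaps : ∀ x ∈ Set.Icc (0 : ℝ) 1, G x ∈ Set.Ioo (0 : ℝ) 1) {p : ℝ}
    (hp : p ∈ Set.Ioo (0 : ℝ) 1) :
    HasDerivAt (Ffun G) (Real.log (G p / (1 - G p)) + (Real.log (1 - p) - Real.log p)) p := by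
  have hcont : ∀ x ∈ Set.Icc (0 : ℝ) 1,
      ContinuousAt (fun x => Real.log (G x / (1 - G x))) x := fun x hx => by
    have h1 : 0 < 1 - G x := sub_pos.2 (hmaps x hx).2
    exact ContinuousAt.log (hG.continuousAt.div₀ (by fun_prop) h1.ne')
      (div_pos (hmaps x hx).1 h1).ne'
  have hint : IntervalIntegrable (fun x => Real.log (G x / (1 - G x))) volume 0 p := by
    refine ContinuousOn.intervalIntegrable fun x hx => (hcont x ?_).continuousWithinAt
    rw [Set.uIcc_of_le hp.1.le] at hx
    exact ⟨hx.1, hx.2.trans hp.2.le⟩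
  have hmeas : Measurable fun x => Real.log (G x / (1 - G x)) := by
    have := hG.measurable
    fun_prop
  rw [Ffun_eq_integral_add_binEntropy]
  exact (intervalIntegral.integral_hasDerivAt_right hint
    hmeas.stronglyMeasurable.stronglyMeasurableAtFilter
    (hcont p (Set.Ioo_subset_Icc_self hp))).add
    (Real.hasDerivAt_binEntropy hp.1.ne' hp.2.ne)

open MeasureTheory in
theorem continuousOn_Ffun {G : ℝ → ℝ} (hG : Continuous G)
    (hmaps : ∀ x ∈ Set.Icc (0 : ℝ) 1, G x ∈ Set.Ioo (0 : ℝ) 1) :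
    ContinuousOn (Ffun G) (Set.Icc 0 1) := by
  have hcont : ContinuousOn (fun x => Real.log (G x / (1 - G x))) (Set.Icc 0 1) :=
    (hG.continuousOn.div (by fun_prop) fun x hx => (sub_pos.2 (hmaps x hx).2).ne').log
      fun x hx => (div_pos (hmaps x hx).1 (sub_pos.2 (hmaps x hx).2)).ne'
  rw [Ffun_eq_integral_add_binEntropy]
  refine ContinuousOn.add ?_ Real.binEntropy_continuous.continuousOn
  have h := intervalIntegral.continuousOn_primitive_interval (μ := volume) (a := 0) (b := 1)
    (f := fun x => Real.log (G x / (1 - G x)))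
    (by rw [Set.uIcc_of_le zero_le_one]; exact hcont.integrableOn_Icc)
  rwa [Set.uIcc_of_le zero_le_one] at h

/-- If `G` lies above the diagonal before `c` and below it after `c`, then `F` has its unique
maximum on `[0,1]` at `c`. -/
theorem Ffun_lt_of_crossing {G : ℝ → ℝ} (hG : Continuous G)
    (hmaps : ∀ x ∈ Set.Icc (0 : ℝ) 1, G x ∈ Set.Ioo (0 : ℝ) 1) {c : ℝ}
    (hc : c ∈ Set.Ioo (0 : ℝ) 1) (habove : ∀ x ∈ Set.Ioo 0 c, x < G x)
    (hbelow : ∀ x ∈ Set.Ioo c 1, G x < x) {q : ℝ} (hq : q ∈ Set.Icc (0 : ℝ) 1) (hqc : q ≠ c) :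
    Ffun G q < Ffun G c := by
  have hlog : ∀ x ∈ Set.Ioo (0 : ℝ) 1,
      Real.log (G x / (1 - G x)) + (Real.log (1 - x) - Real.log x) =
        (Real.log (G x) - Real.log x) + (Real.log (1 - x) - Real.log (1 - G x)) := fun x hx => by
    have h := hmaps x (Set.Ioo_subset_Icc_self hx)
    rw [Real.log_div h.1.ne' (sub_pos.2 h.2).ne']
    ring
  rcases hqc.lt_or_gt with h | h
  · refine strictMonoOn_of_deriv_pos (convex_Icc 0 c) ((continuousOn_Ffun hG hmaps).mono
      (Set.Icc_subset_Icc_right hc.2.le)) (fun x hx => ?_) ⟨hq.1, h.le⟩ ⟨hc.1.le, le_rfl⟩ h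
    rw [interior_Icc] at hx
    have hx1 : x ∈ Set.Ioo (0 : ℝ) 1 := ⟨hx.1, hx.2.trans hc.2⟩
    have hGx := hmaps x (Set.Ioo_subset_Icc_self hx1)
    rw [(hasDerivAt_Ffun hG hmaps hx1).deriv, hlog x hx1]
    have ha := habove x hx
    have h1 := Real.log_lt_log hx.1 ha
    have h2 := Real.log_lt_log (sub_pos.2 hGx.2) (sub_lt_sub_left ha 1)
    linarith
  · refine strictAntiOn_of_deriv_neg (convex_Icc c 1) ((continuousOn_Ffun hG hmaps).mono
      (Set.Icc_subset_Icc_left hc.1.le)) (fun x hx => ?_) ⟨le_rfl, hc.2.le⟩ ⟨h.le, hq.2⟩ h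
    rw [interior_Icc] at hx
    have hx1 : x ∈ Set.Ioo (0 : ℝ) 1 := ⟨hc.1.trans hx.1, hx.2⟩
    have hGx := hmaps x (Set.Ioo_subset_Icc_self hx1)
    rw [(hasDerivAt_Ffun hG hmaps hx1).deriv, hlog x hx1]
    have hb := hbelow x hx
    have h1 := Real.log_lt_log hGx.1 hb
    have h2 := Real.log_lt_log (sub_pos.2 hx1.2) (sub_lt_sub_left hb 1)
    linarith

/-- The unnormalised weight of `i` right steps among the `N` most recent ones. -/
noncomputable def historyWeight (N : ℕ) (G : ℝ → ℝ) (i : ℕ) : ℝ :=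
  (1 / (1 - G ((i : ℝ) / N))) *
    (∏ k ∈ Finset.Icc 1 i, G (((k : ℝ) - 1) / N) / (1 - G (((k : ℝ) - 1) / N))) * (N.choose i)

theorem speedG_eq_sum_historyWeight (N : ℕ) (G : ℝ → ℝ) :
    speedG N G = (∑ i ∈ range (N + 1), historyWeight N G i * (2 * (i : ℝ) / N - 1)) /
      ∑ i ∈ range (N + 1), historyWeight N G i := rfl

theorem natCast_div_mem_Icc {N i : ℕ} (hi : i ≤ N) : (i : ℝ) / N ∈ Set.Icc (0 : ℝ) 1 :=
  ⟨by positivity, div_le_one_of_le₀ (by exact_mod_cast hi) (by positivity)⟩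

theorem historyWeight_pos {N : ℕ} {G : ℝ → ℝ}
    (hmaps : ∀ x ∈ Set.Icc (0 : ℝ) 1, G x ∈ Set.Ioo (0 : ℝ) 1) {i : ℕ} (hi : i ≤ N) :
    0 < historyWeight N G i := by
  have h := hmaps _ (natCast_div_mem_Icc hi)
  refine mul_pos (mul_pos (one_div_pos.2 (sub_pos.2 h.2)) (prod_pos fun k hk => ?_))
    (by exact_mod_cast Nat.choose_pos hi)
  rw [Finset.mem_Icc] at hk
  have hk1 : k - 1 ≤ N := by omega
  have h' := hmaps _ (natCast_div_mem_Icc hk1)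
  rw [Nat.cast_sub hk.1, Nat.cast_one] at h'
  exact div_pos h'.1 (sub_pos.2 h'.2)

/-- Partial sums of the drift telescope, since the weights are the reversible measure of the
birth-death chain with birth rates `(N - i) G(i/N)` and death rates `i (1 - G(i/N))`. -/
theorem sum_range_historyWeight_mul_drift {N : ℕ} {G : ℝ → ℝ}
    (hmaps : ∀ x ∈ Set.Icc (0 : ℝ) 1, G x ∈ Set.Ioo (0 : ℝ) 1) {n : ℕ} (hn : n ≤ N + 1) :
    ∑ i ∈ range n, historyWeight N G i * (N * G ((i : ℝ) / N) - i) =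
      n * (∏ k ∈ Finset.Icc 1 n, G (((k : ℝ) - 1) / N) / (1 - G (((k : ℝ) - 1) / N))) *
        N.choose n := by
  induction n with
  | zero => simp
  | succ n ih =>
    have hnN : n ≤ N := by omega
    have hG : 1 - G ((n : ℝ) / N) ≠ 0 :=
      (sub_pos.2 (hmaps _ (natCast_div_mem_Icc hnN)).2).ne'
    have hchoose : (N.choose (n + 1) : ℝ) * (n + 1) = N.choose n * (N - n) := by
      rw [← Nat.cast_sub hnN]
      exact_mod_cast Nat.choose_succ_right_eq N n
    rw [sum_range_succ, ih (by omega), Finset.prod_Icc_succ_top (by omega), historyWeight]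
    push_cast
    rw [add_sub_cancel_right]
    generalize ∏ k ∈ Finset.Icc 1 n, G (((k : ℝ) - 1) / N) / (1 - G (((k : ℝ) - 1) / N)) = P
    field_simp
    linear_combination (-P * G ((n : ℝ) / N)) * hchoose

theorem sum_historyWeight_mul_drift {N : ℕ} {G : ℝ → ℝ}
    (hmaps : ∀ x ∈ Set.Icc (0 : ℝ) 1, G x ∈ Set.Ioo (0 : ℝ) 1) :
    ∑ i ∈ range (N + 1), historyWeight N G i * (N * G ((i : ℝ) / N) - i) = 0 := by
  simp [sum_range_historyWeight_mul_drift hmaps le_rfl]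

/-- For affine `G` the speed is the same for every window size. -/
theorem speedG_affine {ρ0 ρ1 : ℝ}
    (hmaps : ∀ x ∈ Set.Icc (0 : ℝ) 1, x * ρ1 + (1 - x) * ρ0 ∈ Set.Ioo (0 : ℝ) 1)
    (hden : 1 - ρ1 + ρ0 ≠ 0) {N : ℕ} (hN : N ≠ 0) :
    speedG N (fun p => p * ρ1 + (1 - p) * ρ0) = 2 * (ρ0 / (1 - ρ1 + ρ0)) - 1 := by
  have hpos := sum_pos (s := range (N + 1))
    (fun i hi => historyWeight_pos hmaps (Nat.lt_succ_iff.1 (mem_range.1 hi)))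
    nonempty_range_add_one
  have hN' : (N : ℝ) ≠ 0 := by exact_mod_cast hN
  rw [speedG_eq_sum_historyWeight, div_eq_iff hpos.ne', mul_sum, ← sub_eq_zero,
    ← sum_sub_distrib]
  rw [← mul_zero (-2 / (N * (1 - ρ1 + ρ0))), ← sum_historyWeight_mul_drift hmaps, mul_sum]
  refine sum_congr rfl fun i _ => ?_
  generalize historyWeight N (fun x => x * ρ1 + (1 - x) * ρ0) i = w
  field_simp
  ring

/-- For the linear function `G(p) = pρ₁ + (1-p)ρ₀` with `0 < ρ₀ < ρ₁ < 1`: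
`G` has the unique fixed point `p* = ρ₀/(1-ρ₁+ρ₀)` in `(0,1)`, the function `F`
attains its maximum on `[0,1]` uniquely at `p*`, and consequently
`lim_{N→∞} s(N;G) = 2ρ₀/(1-ρ₁+ρ₀) - 1`. -/
theorem randomized_single_threshold_model (ρ0 ρ1 : ℝ)
    (h0 : 0 < ρ0) (h01 : ρ0 < ρ1) (h1 : ρ1 < 1) :
    (fun p : ℝ => p * ρ1 + (1 - p) * ρ0) (ρ0 / (1 - ρ1 + ρ0)) =
        ρ0 / (1 - ρ1 + ρ0) ∧
    ρ0 / (1 - ρ1 + ρ0) ∈ Set.Ioo (0 : ℝ) 1 ∧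
    (∀ q ∈ Set.Ioo (0 : ℝ) 1,
      (fun p : ℝ => p * ρ1 + (1 - p) * ρ0) q = q → q = ρ0 / (1 - ρ1 + ρ0)) ∧
    (∀ q ∈ Set.Icc (0 : ℝ) 1, q ≠ ρ0 / (1 - ρ1 + ρ0) →
      Ffun (fun p : ℝ => p * ρ1 + (1 - p) * ρ0) q <
        Ffun (fun p : ℝ => p * ρ1 + (1 - p) * ρ0) (ρ0 / (1 - ρ1 + ρ0))) ∧
    Tendsto (fun N => speedG N (fun p : ℝ => p * ρ1 + (1 - p) * ρ0)) atTop
      (𝓝 (2 * (ρ0 / (1 - ρ1 + ρ0)) - 1)) := by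
  have hd : 0 < 1 - ρ1 + ρ0 := by linarith
  have hmaps : ∀ x ∈ Set.Icc (0 : ℝ) 1, x * ρ1 + (1 - x) * ρ0 ∈ Set.Ioo (0 : ℝ) 1 :=
    fun x hx => ⟨by nlinarith [hx.1, hx.2], by nlinarith [hx.1, hx.2]⟩
  have hc : ρ0 / (1 - ρ1 + ρ0) ∈ Set.Ioo (0 : ℝ) 1 :=
    ⟨div_pos h0 hd, (div_lt_one hd).2 (by linarith)⟩
  refine ⟨?_, hc, fun q _ hq => ?_, fun q hq hqc => ?_, ?_⟩
  · field_simp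
    ring
  · rw [eq_div_iff hd.ne']
    linear_combination -hq
  · refine Ffun_lt_of_crossing (by fun_prop) hmaps hc (fun x hx => ?_) (fun x hx => ?_) hq hqc
    · have := (lt_div_iff₀ hd).1 hx.2
      linarith
    · have := (div_lt_iff₀ hd).1 hx.1
      linarith
  · refine tendsto_const_nhds.congr' ?_
    filter_upwards [eventually_ne_atTop 0] with N hN
    exact (speedG_affine hmaps hd.ne' hN).symm
end

section
/- Let 0 < p < 1, let I(s) = log 2 + s log s + (1−s) log(1−s) for s ∈ [0,1] (with 0 log 0 = 0), and let 0 ≤ a ≤ b ≤ 1 with a < b. Suppose M_N and M'_N are integer sequences with 0 ≤ M_N < M'_N ≤ N + 1, M_N/N → a and M'_N/N → b. Then lim_{N→∞} (1/N) log [ 2^{−N} Σ_{j=M_N}^{M'_N − 1} C(N,j) (p/(1−p))^{j − M_N} ] = sup_{s ∈ [a,b]} ( −I(s) + (s − a) log( p/(1−p) ) ), and this supremum equals −log( 2 p^a (1−p)^{1−a} ) if a ≤ p ≤ b, equals −log( 2 a^a (1−a)^{1−a} ) if a > p, and equals −log( 2 b^b (1−b)^{1−b} ((1−p)/p)^{b−a}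 ) if b < p. -/
open Filter Finset Topology

/-- The large deviations rate function `I(s) = log 2 + s log s + (1-s) log(1-s)`
for the empirical mean of i.i.d. Bernoulli(1/2) random variables (with
`0 log 0 = 0`, as `Real.log 0 = 0` in Mathlib). -/
noncomputable def Irate (s : ℝ) : ℝ :=
  Real.log 2 + s * Real.log s + (1 - s) * Real.log (1 - s)

/-- The exponential rate of the tilted binomial weights `2⁻ᴺ C(N, sN) exp (N (s - a) L)`. -/
noncomputable def tiltedRate (a L s : ℝ) : ℝ :=
  -Irate s + (s - a) * L

lemma continuous_tiltedRate (a L : ℝ) : Continuous (tiltedRate a L) := by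
  have h1 : Continuous fun s : ℝ => s * Real.log s := Real.continuous_mul_log
  have h2 : Continuous fun s : ℝ => (1 - s) * Real.log (1 - s) :=
    Real.continuous_mul_log.comp (continuous_const.sub continuous_id)
  unfold tiltedRate Irate
  exact ((continuous_const.add h1).add h2).neg.add
    ((continuous_id.sub continuous_const).mul continuous_const)

lemma log_succ_sub_log_mem_Icc (n : ℕ) :
    Real.log (n + 1 + 1) - Real.log (n + 1) ∈ Set.Icc (1 / (n + 1 + 1 : ℝ)) (1 / (n + 1)) := by
  have hn : (0 : ℝ) < n + 1 := by positivity
  have hn' : (0 : ℝ) < n + 1 + 1 := by positivity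
  rw [← Real.log_div hn'.ne' hn.ne']
  constructor
  · refine le_trans (le_of_eq ?_) (Real.one_sub_inv_le_log_of_pos (by positivity))
    field_simp
    ring
  · refine (Real.log_le_sub_one_of_pos (by positivity)).trans (le_of_eq ?_)
    field_simp
    ring

lemma log_factorial_mem_Icc (n : ℕ) :
    Real.log n.factorial ∈
      Set.Icc (n * Real.log n - n) (n * Real.log n - n + (1 + Real.log n)) := by
  rcases n with _ | n
  · simp
  induction n with
  | zero => simp
  | succ n ih =>
    obtain ⟨h1, h2⟩ := ih
    obtain ⟨h3, h4⟩ := log_succ_sub_log_mem_Icc n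
    rw [Nat.factorial_succ, Nat.cast_mul,
      Real.log_mul (by positivity) (by positivity)]
    push_cast at *
    rw [div_le_iff₀ (by positivity)] at h3
    rw [le_div_iff₀ (by positivity)] at h4
    constructor <;> nlinarith

lemma mul_Irate_div {N j : ℕ} (hN : 0 < N) (hj : j ≤ N) :
    N * Irate (j / N) = N * Real.log 2 + j * Real.log j + (N - j : ℕ) * Real.log (N - j : ℕ)
      - N * Real.log N := by
  have hN' : (N : ℝ) ≠ 0 := by positivity
  have mul_log_div (k : ℕ) :
      N * ((k / N : ℝ) * Real.log (k / N)) = k * Real.log k - k * Real.log N := by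
    rcases Nat.eq_zero_or_pos k with rfl | hk
    · simp
    · rw [Real.log_div (by positivity) hN']
      field_simp
  have h : (1 - j / N : ℝ) = (N - j : ℕ) / N := by
    rw [Nat.cast_sub hj]
    field_simp
  rw [Irate, h, mul_add, mul_add, mul_log_div, mul_log_div, Nat.cast_sub hj]
  ring

lemma abs_log_choose_sub_le {N j : ℕ} (hN : 0 < N) (hj : j ≤ N) :
    |Real.log (N.choose j) - N * (Real.log 2 - Irate (j / N))| ≤ 2 * (1 + Real.log N) := by
  have hc : Real.log N.factorial = Real.log (N.choose j) + Real.log j.factorial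
      + Real.log (N - j).factorial := by
    have hpos : (0 : ℝ) < N.choose j := by exact_mod_cast Nat.choose_pos hj
    rw [← Nat.choose_mul_factorial_mul_factorial hj]
    push_cast
    rw [Real.log_mul (by positivity) (by positivity), Real.log_mul (by positivity) (by positivity)]
  have log_le {k : ℕ} (hk : k ≤ N) : Real.log k ≤ Real.log N := by
    rcases Nat.eq_zero_or_pos k with rfl | hk0
    · simpa using Real.log_natCast_nonneg N
    · exact Real.log_le_log (by positivity) (by exact_mod_cast hk)
  obtain ⟨hN1, hN2⟩ := log_factorial_mem_Icc N
  obtain ⟨hj1, hj2⟩ := log_factorial_mem_Icc j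
  obtain ⟨hk1, hk2⟩ := log_factorial_mem_Icc (N - j)
  have h1 := log_le hj
  have h2 := log_le (Nat.sub_le N j)
  have h3 := Real.log_natCast_nonneg N
  have h4 := mul_Irate_div hN hj
  have h5 : ((N - j : ℕ) : ℝ) = N - j := Nat.cast_sub hj
  rw [abs_le]
  constructor <;> linarith

/-- The logarithm of a single term of the sum, up to a logarithmic error. -/
lemma abs_log_term_sub_le {N j m : ℕ} {r : ℝ} (hr : 0 < r) (hN : 0 < N) (hj : j ≤ N)
    (hm : m ≤ j) :
    |Real.log (1 / 2 ^ N * (N.choose j * r ^ (j - m)))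
        - N * tiltedRate (m / N) (Real.log r) (j / N)| ≤ 2 * (1 + Real.log N) := by
  have hpos : (0 : ℝ) < N.choose j := by exact_mod_cast Nat.choose_pos hj
  have hN' : (N : ℝ) ≠ 0 := by positivity
  convert abs_log_choose_sub_le hN hj using 2
  rw [Real.log_mul (by positivity) (by positivity), Real.log_mul (by positivity) (by positivity),
    Real.log_div one_ne_zero (by positivity), Real.log_pow, Real.log_pow, Real.log_one,
    Nat.cast_sub hm, tiltedRate]
  field_simp
  ring

lemma tendsto_log_div_natCast : Tendsto (fun N : ℕ => Real.log N / N) atTop (𝓝 0) :=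
  Real.isLittleO_log_id_atTop.tendsto_div_nhds_zero.comp tendsto_natCast_atTop_atTop

lemma tendsto_one_add_log_div_natCast (c : ℝ) :
    Tendsto (fun N : ℕ => c * (1 + Real.log N) / N) atTop (𝓝 0) := by
  have h := (tendsto_one_div_atTop_nhds_zero_nat (𝕜 := ℝ)).add tendsto_log_div_natCast
  have h' := h.const_mul c
  rw [add_zero, mul_zero] at h'
  refine h'.congr fun N => ?_
  ring

lemma exists_tendsto_mem_Ico {a b s : ℝ} (ha : 0 ≤ a) (hs : s ∈ Set.Icc a b) {M M' : ℕ → ℕ}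
    (hMM : ∀ N, M N < M' N) (hMa : Tendsto (fun N => (M N : ℝ) / N) atTop (𝓝 a))
    (hMb : Tendsto (fun N => (M' N : ℝ) / N) atTop (𝓝 b)) :
    ∃ j : ℕ → ℕ, (∀ N, j N ∈ Finset.Ico (M N) (M' N)) ∧
      Tendsto (fun N => (j N : ℝ) / N) atTop (𝓝 s) := by
  refine ⟨fun N => max (M N) (min ⌊s * N⌋₊ (M' N - 1)), fun N => ?_, ?_⟩
  · have := hMM N
    rw [Finset.mem_Ico]
    dsimp only
    omega
  · have hfloor : Tendsto (fun N : ℕ => (⌊s * N⌋₊ : ℝ) / N) atTop (𝓝 s) :=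
      (tendsto_nat_floor_mul_div_atTop (ha.trans hs.1)).comp tendsto_natCast_atTop_atTop
    have hlast : Tendsto (fun N : ℕ => ((M' N - 1 : ℕ) : ℝ) / N) atTop (𝓝 b) := by
      have h := hMb.sub (tendsto_one_div_atTop_nhds_zero_nat (𝕜 := ℝ))
      rw [sub_zero] at h
      refine h.congr fun N => ?_
      rw [Nat.cast_sub (by have := hMM N; omega), Nat.cast_one, sub_div]
    have h := hMa.max (hfloor.min hlast)
    rw [min_eq_left hs.2, max_eq_right hs.1] at h
    refine h.congr fun N => ?_
    rw [Nat.cast_max, Nat.cast_min, min_div_div_right (Nat.cast_nonneg N),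
      max_div_div_right (Nat.cast_nonneg N)]

lemma eventually_forall_Icc_lt {f : ℝ → ℝ} (hf : Continuous f) {a b c : ℝ} (hab : a ≤ b)
    (hc : ∀ x ∈ Set.Icc a b, f x < c) {u v : ℕ → ℝ} (hu : Tendsto u atTop (𝓝 a))
    (hv : Tendsto v atTop (𝓝 b)) : ∀ᶠ N in atTop, ∀ x ∈ Set.Icc (u N) (v N), f x < c := by
  obtain ⟨δ, hδ, hsub⟩ := (isCompact_Icc (a := a) (b := b)).exists_thickening_subset_open
    (isOpen_lt hf continuous_const) hc
  filter_upwards [hu.eventually_const_lt (sub_lt_self a hδ),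
    hv.eventually_lt_const (lt_add_of_pos_right b hδ)] with N hN1 hN2 x hx
  refine hsub (Metric.mem_thickening_iff.2
    ⟨max a (min x b), ⟨le_max_left _ _, max_le hab (min_le_right _ _)⟩, ?_⟩)
  rw [Real.dist_eq, abs_lt]
  have h1 := hx.1
  have h2 := hx.2
  rcases le_total x b with h | h <;> simp only [h, min_eq_left, min_eq_right]
  · rcases le_total a x with h' | h' <;> simp only [h', max_eq_left, max_eq_right] <;>
      constructor <;> linarith
  · rw [max_eq_right hab]
    constructor <;> linarith

/-- Laplace's method for the tilted binomial sum, in terms of a maximizer of the rate. -/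
theorem tendsto_log_binomial_sum {r a b s : ℝ} (hr : 0 < r) (ha : 0 ≤ a)
    (hs : s ∈ Set.Icc a b) (hmax : IsMaxOn (tiltedRate a (Real.log r)) (Set.Icc a b) s)
    {M M' : ℕ → ℕ} (hMM : ∀ N, M N < M' N ∧ M' N ≤ N + 1)
    (hMa : Tendsto (fun N => (M N : ℝ) / N) atTop (𝓝 a))
    (hMb : Tendsto (fun N => (M' N : ℝ) / N) atTop (𝓝 b)) :
    Tendsto (fun N : ℕ => (1 / (N : ℝ)) * Real.log ((1 / 2 ^ N) *
        ∑ j ∈ Finset.Ico (M N) (M' N), (N.choose j : ℝ) * r ^ (j - M N)))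
      atTop (𝓝 (tiltedRate a (Real.log r) s)) := by
  set L := Real.log r
  have hshift (N : ℕ) (x : ℝ) :
      tiltedRate (M N / N) L x = tiltedRate a L x + (a - M N / N) * L := by
    unfold tiltedRate
    ring
  have hshift_lim : Tendsto (fun N : ℕ => (a - M N / N) * L) atTop (𝓝 0) := by
    simpa using (hMa.const_sub a).mul_const L
  have hterm_pos {N j : ℕ} (hj : j ∈ Finset.Ico (M N) (M' N)) :
      (0 : ℝ) < 1 / 2 ^ N * (N.choose j * r ^ (j - M N)) := by
    have := (hMM N).2
    have : (0 : ℝ) < N.choose j := by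
      exact_mod_cast Nat.choose_pos (by rw [Finset.mem_Ico] at hj; omega)
    positivity
  have hterm {N j : ℕ} (hN : 0 < N) (hj : j ∈ Finset.Ico (M N) (M' N)) :=
    abs_le.1 (abs_log_term_sub_le (m := M N) hr hN
      (by have := (hMM N).2; rw [Finset.mem_Ico] at hj; omega) (Finset.mem_Ico.1 hj).1)
  simp_rw [Finset.mul_sum]
  rw [tendsto_order]
  constructor
  · intro c hc
    obtain ⟨j, hj, hjs⟩ := exists_tendsto_mem_Ico ha hs (fun N => (hMM N).1) hMa hMb
    have hlim := ((((continuous_tiltedRate a L).tendsto s).comp hjs).add hshift_lim).sub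
      (tendsto_one_add_log_div_natCast 2)
    rw [add_zero, sub_zero] at hlim
    filter_upwards [hlim.eventually_const_lt hc, eventually_gt_atTop 0] with N hN hN0
    refine hN.trans_le ?_
    have hN0' : (0 : ℝ) < N := by exact_mod_cast hN0
    have h1 := (hterm hN0 (hj N)).1
    have h2 := Real.log_le_log (hterm_pos (hj N))
      (Finset.single_le_sum (f := fun j => (1 / 2 ^ N * (N.choose j * r ^ (j - M N)) : ℝ))
        (fun i hi => (hterm_pos hi).le) (hj N))
    rw [hshift] at h1
    rw [one_div_mul_eq_div, le_div_iff₀ hN0', sub_mul, div_mul_cancel₀ _ hN0'.ne']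
    simp only [Function.comp_apply]
    linarith
  · intro c hc
    obtain ⟨c', hc', hcc⟩ := exists_between hc
    have hev := eventually_forall_Icc_lt (continuous_tiltedRate a L) (hs.1.trans hs.2)
      (fun x hx => (hmax hx).trans_lt hc') hMa hMb
    have hlim := (hshift_lim.const_add c').add (tendsto_one_add_log_div_natCast 4)
    rw [add_zero, add_zero] at hlim
    filter_upwards [hev, hlim.eventually_lt_const hcc, eventually_gt_atTop 0] with N hmaxN hN hN0
    refine LE.le.trans_lt ?_ hN
    have hN0' : (0 : ℝ) < N := by exact_mod_cast hN0
    set B := N * (c' + (a - M N / N) * L) + 2 * (1 + Real.log N) with hB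
    have hbound : ∀ j ∈ Finset.Ico (M N) (M' N),
        (1 / 2 ^ N * (N.choose j * r ^ (j - M N)) : ℝ) ≤ Real.exp B := by
      intro j hj
      have h1 := (hterm hN0 hj).2
      rw [hshift] at h1
      rw [Finset.mem_Ico] at hj
      have h2 := hmaxN (j / N) ⟨by gcongr; exact hj.1, by gcongr; exact hj.2.le⟩
      rw [← Real.log_le_iff_le_exp (hterm_pos (Finset.mem_Ico.2 hj)), hB]
      nlinarith
    have hsum := Finset.sum_le_card_nsmul _ _ _ hbound
    have hcard : ((Finset.Ico (M N) (M' N)).card : ℝ) ≤ 2 * N := by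
      rw [Nat.card_Ico]
      have := (hMM N).2
      exact_mod_cast (show M' N - M N ≤ 2 * N by omega)
    have hpos : (0 : ℝ) < ∑ j ∈ Finset.Ico (M N) (M' N),
        (1 / 2 ^ N * (N.choose j * r ^ (j - M N)) : ℝ) :=
      Finset.sum_pos (fun i hi => hterm_pos hi) (Finset.nonempty_Ico.2 (hMM N).1)
    rw [nsmul_eq_mul] at hsum
    have h3 := Real.log_le_log hpos
      (hsum.trans (mul_le_mul_of_nonneg_right hcard (Real.exp_pos B).le))
    rw [Real.log_mul (by positivity) (Real.exp_pos B).ne', Real.log_exp,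
      Real.log_mul two_ne_zero hN0'.ne'] at h3
    have h4 := Real.log_natCast_nonneg N
    have h5 := Real.log_two_lt_d9
    rw [one_div_mul_eq_div, div_le_iff₀ hN0', add_mul, div_mul_cancel₀ _ hN0'.ne']
    linarith

lemma concaveOn_tiltedRate (a L : ℝ) : ConcaveOn ℝ (Set.Icc 0 1) (tiltedRate a L) := by
  have h1 : ConcaveOn ℝ (Set.Icc 0 1) Real.binEntropy := Real.strictConcave_binEntropy.concaveOn
  have h2 : ConcaveOn ℝ (Set.Icc 0 1) fun s : ℝ => L * s :=
    (LinearMap.mulLeft ℝ L).concaveOn (convex_Icc 0 1)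
  refine ((h1.add h2).add_const (-Real.log 2 - a * L)).congr fun s _ => ?_
  simp only [tiltedRate, Irate, Real.binEntropy, Real.log_inv, Pi.add_apply]
  ring

lemma mul_log_sub_log_le {x y : ℝ} (hx : 0 ≤ x) (hy : 0 < y) :
    x * (Real.log y - Real.log x) ≤ y - x := by
  rcases hx.eq_or_lt with rfl | hx
  · simpa using hy.le
  · have h := mul_le_mul_of_nonneg_left (Real.log_le_sub_one_of_pos (div_pos hy hx)) hx.le
    rwa [Real.log_div hy.ne' hx.ne', mul_sub_one, mul_div_cancel₀ _ hx.ne'] at h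

/-- Gibbs' inequality: the rate with tilt `log (p / (1 - p))` is maximal at `p`. -/
lemma isMaxOn_tiltedRate (a : ℝ) {p : ℝ} (hp0 : 0 < p) (hp1 : p < 1) :
    IsMaxOn (tiltedRate a (Real.log (p / (1 - p)))) (Set.Icc 0 1) p := by
  intro s hs
  have hq : 0 < 1 - p := sub_pos.2 hp1
  have h1 := mul_log_sub_log_le hs.1 hp0
  have h2 := mul_log_sub_log_le (sub_nonneg.2 hs.2) hq
  simp only [Set.mem_ofPred_eq, tiltedRate, Irate, Real.log_div hp0.ne' hq.ne']
  nlinarith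

lemma ConcaveOn.le_of_isMaxOn_of_mem_segment {f : ℝ → ℝ} {t : Set ℝ} (hf : ConcaveOn ℝ t f)
    {p s x : ℝ} (hp : p ∈ t) (hs : s ∈ t) (hmax : IsMaxOn f t p) (hx : x ∈ segment ℝ s p) :
    f s ≤ f x :=
  (le_min le_rfl (hmax hs)).trans (hf.ge_on_segment hs hp hx)

/-- The Laplace-method limit: if `M_N/N → a`, `M'_N/N → b` with `a < b`, then
`(1/N) log (2^{-N} ∑_{j=M_N}^{M'_N-1} C(N,j) (p/(1-p))^{j-M_N})` converges to
`sup_{s∈[a,b]} (-I(s) + (s-a) log(p/(1-p)))`, and this supremum is given by the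
explicit three-case formula. -/
theorem laplace_asymptotics_of_binomial_sum (p a b : ℝ)
    (hp0 : 0 < p) (hp1 : p < 1) (ha : 0 ≤ a) (hab : a < b) (hb : b ≤ 1)
    (M M' : ℕ → ℕ) (hMM : ∀ N, M N < M' N ∧ M' N ≤ N + 1)
    (hMa : Tendsto (fun N => (M N : ℝ) / N) atTop (𝓝 a))
    (hMb : Tendsto (fun N => (M' N : ℝ) / N) atTop (𝓝 b))
    (V : ℝ)
    (hV : V = sSup ((fun s => -Irate s + (s - a) * Real.log (p / (1 - p))) ''
      Set.Icc a b)) :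
    Tendsto (fun N : ℕ => (1 / (N : ℝ)) * Real.log ((1 / 2 ^ N) *
        ∑ j ∈ Finset.Ico (M N) (M' N),
          (N.choose j : ℝ) * (p / (1 - p)) ^ (j - M N)))
      atTop (𝓝 V) ∧
    (a ≤ p → p ≤ b → V = -Real.log (2 * p ^ a * (1 - p) ^ (1 - a))) ∧
    (p < a → V = -Real.log (2 * a ^ a * (1 - a) ^ (1 - a))) ∧
    (b < p → V = -Real.log (2 * b ^ b * (1 - b) ^ (1 - b) *
      ((1 - p) / p) ^ (b - a))) := by
  have hq : 0 < 1 - p := sub_pos.2 hp1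
  have hr : 0 < p / (1 - p) := div_pos hp0 hq
  have hV' : V = sSup (tiltedRate a (Real.log (p / (1 - p))) '' Set.Icc a b) := hV
  have eq_of_isMaxOn {s : ℝ} (hs : s ∈ Set.Icc a b)
      (hmax : IsMaxOn (tiltedRate a (Real.log (p / (1 - p)))) (Set.Icc a b) s) :
      V = tiltedRate a (Real.log (p / (1 - p))) s := by
    rw [hV']
    exact IsGreatest.csSup_eq ⟨Set.mem_image_of_mem _ hs, Set.forall_mem_image.2 fun x hx => hmax hx⟩
  have hsub : Set.Icc a b ⊆ Set.Icc 0 1 := Set.Icc_subset_Icc ha hb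
  have hp : p ∈ Set.Icc (0 : ℝ) 1 := ⟨hp0.le, hp1.le⟩
  have hmax := isMaxOn_tiltedRate a hp0 hp1
  have hconc := concaveOn_tiltedRate a (Real.log (p / (1 - p)))
  refine ⟨?_, fun hap hpb => ?_, fun hpa => ?_, fun hbp => ?_⟩
  · obtain ⟨s, hs, hsmax⟩ := isCompact_Icc.exists_isMaxOn (Set.nonempty_Icc.2 hab.le)
      (continuous_tiltedRate a (Real.log (p / (1 - p)))).continuousOn
    rw [eq_of_isMaxOn hs hsmax]
    exact tendsto_log_binomial_sum hr ha hs hsmax hMM hMa hMb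
  · rw [eq_of_isMaxOn ⟨hap, hpb⟩ (hmax.on_subset hsub), Real.log_mul (by positivity) (by positivity),
      Real.log_mul (by positivity) (by positivity), Real.log_rpow hp0, Real.log_rpow hq,
      tiltedRate, Irate, Real.log_div hp0.ne' hq.ne']
    ring
  · have ha0 : 0 < a := hp0.trans hpa
    have ha1 : 0 < 1 - a := by linarith
    rw [eq_of_isMaxOn (Set.left_mem_Icc.2 hab.le) fun s hs =>
      hconc.le_of_isMaxOn_of_mem_segment hp (hsub hs) hmax
        (by rw [segment_symm, segment_eq_Icc (hpa.le.trans hs.1)]; exact ⟨hpa.le, hs.1⟩),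
      Real.log_mul (by positivity) (by positivity),
      Real.log_mul (by positivity) (by positivity), Real.log_rpow ha0, Real.log_rpow ha1,
      tiltedRate, Irate]
    ring
  · have hb0 : 0 < b := ha.trans_lt hab
    have hb1 : 0 < 1 - b := by linarith
    rw [eq_of_isMaxOn (Set.right_mem_Icc.2 hab.le) fun s hs =>
      hconc.le_of_isMaxOn_of_mem_segment hp (hsub hs) hmax
        (by rw [segment_eq_Icc (hs.2.trans hbp.le)]; exact ⟨hs.2, hbp.le⟩),
      Real.log_mul (by positivity) (by positivity), Real.log_mul (by positivity) (by positivity),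
      Real.log_mul (by positivity) (by positivity), Real.log_rpow hb0, Real.log_rpow hb1,
      Real.log_rpow (by positivity), Real.log_div hq.ne' hp0.ne',
      tiltedRate, Irate, Real.log_div hp0.ne' hq.ne']
    ring
end
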